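/- Let v_1, …, v_r ∈ ℚ^ρ and let T_1, …, T_k ⊆ {1, …, r} be index sets such that: (a) for each j the family (v_i)_{i ∈ T_j} is linearly independent; (b) cone({v_1, …, v_r}) = ⋃_{j=1}^k cone({v_i : i ∈ T_j}); and (c) every index i ∈ {1, …, r} belongs to some T_j. Let V_1, …, V_r be nonempty finite subsets of ℚ^n and set Δ_i = conv(V_i). Let C ⊆ ℝ^n × ℝ^ρ be a convex set such that (i) the image of C under the projection pr₂ : ℝ^n × ℝ^ρ → ℝ^ρ is contained in cone({v_1, …, v_r}), and (ii) for every j and every collection of nonnegative reals (a_i)_{i ∈ T_j}, the fiber {x ∈ ℝ^n : (x, Σ_{i ∈ T_j} a_i v_i) ∈ C} equals the Minkowski sum Σ_{i ∈ T_j} a_i•Δ_i. Then C is the convex cone generated by the finite set {(x, v_i) : 1 ≤ i ≤ r, x ∈ V_i}; in particular, C is a rational polyhedral convex cone. -/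

import Mathlib

open Pointwise

/-- The convex cone generated by a set `Q`: all finite nonnegative linear
combinations of elements of `Q` (the empty combination giving `0`). -/
def coneGen {E : Type*} [AddCommMonoid E] [Module ℝ E] (Q : Set E) : Set E :=
  {x | ∃ (k : ℕ) (c : Fin k → ℝ) (g : Fin k → E),
    (∀ i, 0 ≤ c i) ∧ (∀ i, g i ∈ Q) ∧ x = ∑ i, c i • g i}

/-- The embedding `ℚ^n → ℝ^n`. -/
def qtor {n : ℕ} (x : Fin n → ℚ) : Fin n → ℝ := fun j => (x j : ℝ)

/-- The set `coneGen Q` is the pointed cone spanned by `Q`. -/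
theorem coneGen_eq_span {E : Type*} [AddCommGroup E] [Module ℝ E] (Q : Set E) :
    coneGen Q = (Submodule.span NNReal Q : Set E) := by
  ext x
  rw [SetLike.mem_coe, Submodule.mem_span_set']
  constructor
  · rintro ⟨k, c, g, hc, hg, rfl⟩
    exact ⟨k, fun i => ⟨c i, hc i⟩, fun i => ⟨g i, hg i⟩, rfl⟩
  · rintro ⟨k, c, g, rfl⟩
    exact ⟨k, fun i => c i, fun i => g i, fun i => (c i).2, fun i => (g i).2, rfl⟩

theorem smul_mem_coneGen {E : Type*} [AddCommGroup E] [Module ℝ E] {Q : Set E} {t : ℝ} {x : E}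
    (ht : 0 ≤ t) (hx : x ∈ coneGen Q) : t • x ∈ coneGen Q := by
  rw [coneGen_eq_span] at hx ⊢
  exact (Submodule.span NNReal Q).smul_mem ⟨t, ht⟩ hx

theorem sum_mem_coneGen {E ι : Type*} [AddCommGroup E] [Module ℝ E] {Q : Set E} {s : Finset ι}
    {f : ι → E} (hf : ∀ i ∈ s, f i ∈ coneGen Q) : ∑ i ∈ s, f i ∈ coneGen Q := by
  rw [coneGen_eq_span] at hf ⊢
  exact (Submodule.span NNReal Q).sum_mem hf

theorem subset_coneGen {E : Type*} [AddCommGroup E] [Module ℝ E] (Q : Set E) :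
    Q ⊆ coneGen Q := by
  rw [coneGen_eq_span]
  exact Submodule.subset_span

theorem convex_coneGen {E : Type*} [AddCommGroup E] [Module ℝ E] (Q : Set E) :
    Convex ℝ (coneGen Q) := by
  intro x hx y hy a b ha hb _
  have hx' := smul_mem_coneGen ha hx
  have hy' := smul_mem_coneGen hb hy
  rw [coneGen_eq_span] at hx' hy' ⊢
  exact (Submodule.span NNReal Q).add_mem hx' hy'

/-- A convex set containing `0` and closed under nonnegative scaling contains the cone generated
by each of its subsets. -/
theorem coneGen_subset {E : Type*} [AddCommGroup E] [Module ℝ E] {Q C : Set E}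
    (hconv : Convex ℝ C) (h0 : (0 : E) ∈ C)
    (hsmul : ∀ t : ℝ, 0 ≤ t → ∀ p ∈ C, t • p ∈ C) (hQ : Q ⊆ C) : coneGen Q ⊆ C := by
  rintro _ ⟨k, c, g, hc, hg, rfl⟩
  refine Finset.sum_induction _ (· ∈ C) (fun p q hp hq => ?_) h0
    (fun i _ => hsmul _ (hc i) _ (hQ (hg i)))
  have h := hsmul 2 zero_le_two _
    (hconv hp hq (by norm_num : (0 : ℝ) ≤ 1 / 2) (by norm_num : (0 : ℝ) ≤ 1 / 2) (by norm_num))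
  rw [smul_add, smul_smul, smul_smul] at h
  norm_num at h
  exact h

/-- A member of the cone generated by a finite family is a nonnegative combination indexed by
that family. -/
theorem exists_coeff_of_mem_coneGen_image {E ι : Type*} [AddCommGroup E] [Module ℝ E]
    {w : ι → E} {s : Finset ι} {x : E} (hx : x ∈ coneGen (w '' (s : Set ι))) :
    ∃ a : ι → ℝ, (∀ i, 0 ≤ a i) ∧ x = ∑ i ∈ s, a i • w i := by
  rw [coneGen_eq_span, SetLike.mem_coe, Submodule.mem_span_image_finset_iff_exists_fun'] at hx
  obtain ⟨c, rfl⟩ := hx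
  exact ⟨fun i => c i, fun i => (c i).2, rfl⟩

/-- If `x ∈ conv W`, then `(x, y)` lies in any convex set containing all `(w, y)` with
`w ∈ W`. -/
theorem prod_mk_mem_of_mem_convexHull {E F : Type*} [AddCommGroup E] [Module ℝ E]
    [AddCommGroup F] [Module ℝ F] {W : Set E} {y : F} {D : Set (E × F)} (hD : Convex ℝ D)
    (hW : ∀ w ∈ W, (w, y) ∈ D) {x : E} (hx : x ∈ convexHull ℝ W) : (x, y) ∈ D := by
  have hconv : Convex ℝ {z : E | (z, y) ∈ D} := by
    intro p hp q hq a b ha hb hab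
    have h := hD hp hq ha hb hab
    rwa [Prod.smul_mk, Prod.smul_mk, Prod.mk_add_mk, ← add_smul, hab, one_smul] at h
  exact convexHull_min hW hconv hx

/-- Convex-geometric form of the main theorem: let `v 1, …, v r ∈ ℚ^ρ` and let
`T 1, …, T k ⊆ {1, …, r}` be index sets such that (a) each family `(vᵢ)_{i ∈ Tⱼ}` is
linearly independent, (b) `cone{v₁,…,vᵣ} = ⋃ⱼ cone{vᵢ : i ∈ Tⱼ}`, and (c) every index
lies in some `Tⱼ`.  Let `V 1, …, V r` be nonempty finite subsets of `ℚ^n`, with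
`Δᵢ = conv(Vᵢ)`.  If `C ⊆ ℝ^n × ℝ^ρ` is a convex set whose image under the second
projection is contained in `cone{v₁,…,vᵣ}`, and whose fiber over each point
`∑_{i ∈ Tⱼ} aᵢ vᵢ` (with `aᵢ ≥ 0`) is the Minkowski sum `∑_{i ∈ Tⱼ} aᵢ•Δᵢ`, then `C`
is the convex cone generated by the finite set `{(x, vᵢ) : x ∈ Vᵢ}`; in particular,
`C` is a rational polyhedral convex cone. -/
theorem stmt_2 (n ρ r k : ℕ)
    (v : Fin r → (Fin ρ → ℚ)) (T : Fin k → Finset (Fin r))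
    (ha : ∀ j, LinearIndependent ℝ (fun i : {i : Fin r // i ∈ T j} => qtor (v i)))
    (hb : coneGen (Set.range fun i => qtor (v i)) =
        ⋃ j, coneGen ((fun i => qtor (v i)) '' (T j : Set (Fin r))))
    (hc : ∀ i : Fin r, ∃ j, i ∈ T j)
    (V : Fin r → Finset (Fin n → ℚ)) (hV : ∀ i, (V i).Nonempty)
    (C : Set ((Fin n → ℝ) × (Fin ρ → ℝ))) (hconv : Convex ℝ C)
    (hproj : Prod.snd '' C ⊆ coneGen (Set.range fun i => qtor (v i)))
    (hfiber : ∀ j : Fin k, ∀ a : Fin r → ℝ, (∀ i ∈ T j, 0 ≤ a i) →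
        {x : Fin n → ℝ | (x, ∑ i ∈ T j, a i • qtor (v i)) ∈ C}
          = ∑ i ∈ T j, a i • convexHull ℝ (qtor '' (V i : Set (Fin n → ℚ)))) :
    C = coneGen {q : (Fin n → ℝ) × (Fin ρ → ℝ) |
        ∃ i : Fin r, ∃ x ∈ V i, q = (qtor x, qtor (v i))} := by
  classical
  have hmem : ∀ p ∈ C, ∃ j, ∃ a : Fin r → ℝ, ∃ d : Fin r → Fin n → ℝ, (∀ i, 0 ≤ a i) ∧
      (∀ i ∈ T j, d i ∈ convexHull ℝ (qtor '' (V i : Set (Fin n → ℚ)))) ∧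
      p = ∑ i ∈ T j, a i • (d i, qtor (v i)) := by
    rintro ⟨x, y⟩ hp
    have hy := hproj ⟨_, hp, rfl⟩
    rw [hb, Set.mem_iUnion] at hy
    obtain ⟨j, hy⟩ := hy
    obtain ⟨a, ha0, rfl⟩ := exists_coeff_of_mem_coneGen_image hy
    have hx : x ∈ ∑ i ∈ T j, a i • convexHull ℝ (qtor '' (V i : Set (Fin n → ℚ))) := by
      rw [← hfiber j a fun i _ => ha0 i]
      exact hp
    rw [Set.mem_finsetSum] at hx
    obtain ⟨g, hg, rfl⟩ := hx
    choose! d hd hdg using fun i (hi : i ∈ T j) => Set.mem_smul_set.1 (hg hi)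
    refine ⟨j, a, d, ha0, hd, Prod.ext ?_ ?_⟩
    · simpa [Prod.fst_sum] using Finset.sum_congr rfl fun i hi => (hdg i hi).symm
    · simp [Prod.snd_sum]
  have hmk : ∀ j, ∀ a : Fin r → ℝ, ∀ d : Fin r → Fin n → ℝ, (∀ i, 0 ≤ a i) →
      (∀ i ∈ T j, d i ∈ convexHull ℝ (qtor '' (V i : Set (Fin n → ℚ)))) →
      ∑ i ∈ T j, a i • (d i, qtor (v i)) ∈ C := by
    intro j a d ha0 hd
    have hx : ∑ i ∈ T j, a i • d i ∈
        {x : Fin n → ℝ | (x, ∑ i ∈ T j, a i • qtor (v i)) ∈ C} := by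
      rw [hfiber j a fun i _ => ha0 i]
      exact Set.finsetSum_mem_finsetSum _ _ _ fun i hi => Set.smul_mem_smul_set (hd i hi)
    convert Set.mem_ofPred_eq ▸ hx using 1
    exact Prod.ext (by simp [Prod.fst_sum]) (by simp [Prod.snd_sum])
  choose e he using hV
  have heconv : ∀ i, qtor (e i) ∈ convexHull ℝ (qtor '' (V i : Set (Fin n → ℚ))) := fun i =>
    subset_convexHull _ _ ⟨e i, he i, rfl⟩
  apply Set.Subset.antisymm
  · intro p hp
    obtain ⟨j, a, d, ha0, hd, rfl⟩ := hmem p hp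
    refine sum_mem_coneGen fun i hi => smul_mem_coneGen (ha0 i) ?_
    refine prod_mk_mem_of_mem_convexHull (convex_coneGen _) ?_ (hd i hi)
    rintro _ ⟨x, hx, rfl⟩
    exact subset_coneGen _ ⟨i, x, hx, rfl⟩
  · refine coneGen_subset hconv ?_ ?_ ?_
    · have h0 : (0 : Fin ρ → ℝ) ∈ coneGen (Set.range fun i => qtor (v i)) :=
        ⟨0, Fin.elim0, Fin.elim0, fun i => i.elim0, fun i => i.elim0, by simp⟩
      rw [hb, Set.mem_iUnion] at h0
      obtain ⟨j, -⟩ := h0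
      simpa using hmk j 0 (fun i => qtor (e i)) (fun _ => le_rfl) fun i _ => heconv i
    · intro t ht p hp
      obtain ⟨j, a, d, ha0, hd, rfl⟩ := hmem p hp
      simpa only [Finset.smul_sum, smul_smul] using
        hmk j (fun i => t * a i) d (fun i => mul_nonneg ht (ha0 i)) hd
    · rintro _ ⟨i, x, hx, rfl⟩
      obtain ⟨j, hj⟩ := hc i
      have h := hmk j (Pi.single i 1) (Function.update (fun i => qtor (e i)) i (qtor x))
        (fun l => by by_cases hl : l = i <;> simp [hl]) ?_
      · rw [Finset.sum_eq_single_of_mem i hj fun l _ hl => by simp [hl]] at h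
        simpa using h
      · intro l _
        by_cases hl : l = i
        · subst hl
          simpa using subset_convexHull ℝ _ (Set.mem_image_of_mem qtor hx)
        · simpa [hl] using heconv l
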